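/- arXiv:1507.08611 — 4 statements merged into one kernel-verified Lean document; each statement's English description precedes it below -/
import Mathlib

section
/- Let B be a separable Banach space, H a Hilbert space, and i : B → H a continuous dense embedding with ‖i u‖_H ≤ ‖u‖_B for all u ∈ B. Let T : B → B be a bounded linear operator that is symmetric with respect to the inner product of H, i.e., ⟨i (T u), i v⟩_H = ⟨i u, i (T v)⟩_H for all u, v ∈ B. Then T is bounded with respect to the H-norm: there exists a unique bounded linear operator T̄ : H → H with T̄ ∘ i = i ∘ T, and moreover ‖T̄‖_{L(H)} ≤ ‖T‖_{L(B)} (in particular ‖T̄‖²_{L(H)} ≤ k ‖T‖²_{L(B)} for a positive constant k). -/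
theorem lax_aux (a : ℕ → ℝ) (c M : ℝ) (hc : 0 ≤ c) (ha : ∀ n, 0 ≤ a n)
    (hconv : ∀ n, a (n + 1) ^ 2 ≤ a n * a (n + 2)) (hb : ∀ n, a n ≤ c ^ n * M) :
    a 1 ≤ c * a 0 := by
  by_contra! hlt
  have h0 : 0 < a 0 := by
    rcases (ha 0).eq_or_lt with h | h
    · have h1 := hconv 0
      rw [← h] at h1 hlt
      simp only [zero_add, zero_mul, mul_zero] at h1 hlt
      nlinarith
    · exact h
  set r := a 1 / a 0 with hr
  have hcr : c < r := by rwa [hr, lt_div_iff₀ h0]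
  have hr0 : 0 < r := hc.trans_lt hcr
  have step : ∀ n, 0 < a n ∧ r * a n ≤ a (n + 1) := by
    intro n
    induction n with
    | zero => exact ⟨h0, by rw [hr, div_mul_cancel₀ _ h0.ne']⟩
    | succ k ih =>
      obtain ⟨h1, h2⟩ := ih
      have h3 : 0 < a (k + 1) := (mul_pos hr0 h1).trans_le h2
      refine ⟨h3, ?_⟩
      have h4 := hconv k
      have h5 : a k * (r * a (k + 1)) ≤ a k * a (k + 2) := by
        nlinarith [mul_le_mul_of_nonneg_right h2 h3.le]
      exact le_of_mul_le_mul_left h5 h1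
  have grow : ∀ n, r ^ n * a 0 ≤ a n := by
    intro n
    induction n with
    | zero => simp
    | succ k ih =>
      calc r ^ (k + 1) * a 0 = r * (r ^ k * a 0) := by ring
        _ ≤ r * a k := by gcongr
        _ ≤ a (k + 1) := (step k).2
  have hle : ∀ n, a 0 ≤ (c / r) ^ n * M := by
    intro n
    rw [div_pow, div_mul_eq_mul_div, le_div_iff₀ (pow_pos hr0 n), mul_comm]
    exact (grow n).trans (hb n)
  have ht : Filter.Tendsto (fun n : ℕ => (c / r) ^ n * M) Filter.atTop (nhds (0 * M)) :=
    (tendsto_pow_atTop_nhds_zero_of_lt_one (div_nonneg hc hr0.le)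
      ((div_lt_one hr0).2 hcr)).mul_const M
  have := ge_of_tendsto' ht hle
  linarith

/-- (Lax's theorem, part (1).) Let `B` be a separable Banach space, `H` a Hilbert space,
`i : B → H` a continuous dense embedding with `‖i u‖ ≤ ‖u‖`, and let `T : B → B` be a
bounded linear operator symmetric with respect to the inner product of `H`.  Then `T` is
bounded with respect to the `H`-norm: there is a unique bounded operator `T̄ : H → H` with
`T̄ ∘ i = i ∘ T`, and moreover `‖T̄‖ ≤ ‖T‖`. -/
theorem lax_theorem_bounded_extension {𝕜 : Type*} [RCLike 𝕜] (B H : Type*)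
    [NormedAddCommGroup B] [NormedSpace 𝕜 B] [CompleteSpace B]
    [TopologicalSpace.SeparableSpace B]
    [NormedAddCommGroup H] [InnerProductSpace 𝕜 H] [CompleteSpace H]
    (i : B →L[𝕜] H) (hinj : Function.Injective i) (hdense : DenseRange i)
    (hle : ∀ u : B, ‖i u‖ ≤ ‖u‖)
    (T : B →L[𝕜] B)
    (hsym : ∀ u v : B, (inner 𝕜 (i (T u)) (i v) : 𝕜) = inner 𝕜 (i u) (i (T v))) :
    ∃ Tbar : H →L[𝕜] H, (∀ u : B, Tbar (i u) = i (T u)) ∧ ‖Tbar‖ ≤ ‖T‖ ∧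
      ∀ S : H →L[𝕜] H, (∀ u : B, S (i u) = i (T u)) → S = Tbar := by
  have key : ∀ u : B, ‖i (T u)‖ ≤ ‖T‖ * ‖i u‖ := by
    intro u
    refine lax_aux (fun n => ‖i ((T ^ n) u)‖) ‖T‖ ‖u‖ (norm_nonneg _)
      (fun n => norm_nonneg _) ?_ ?_
    · intro n
      have e1 : (T ^ (n + 1)) u = T ((T ^ n) u) := by rw [pow_succ']; rfl
      have e2 : (T ^ (n + 2)) u = T (T ((T ^ n) u)) := by
        rw [pow_succ', pow_succ']; rfl
      simp only [e1, e2]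
      set w := (T ^ n) u
      have h := norm_inner_le_norm (𝕜 := 𝕜) (i w) (i (T (T w)))
      rw [← hsym, inner_self_eq_norm_sq_to_K] at h
      simpa using h
    · intro n
      have h : ∀ n : ℕ, ‖(T ^ n) u‖ ≤ ‖T‖ ^ n * ‖u‖ := by
        intro n
        induction n with
        | zero => simp
        | succ k ih =>
          have e1 : (T ^ (k + 1)) u = T ((T ^ k) u) := by rw [pow_succ']; rfl
          rw [e1]
          calc ‖T ((T ^ k) u)‖ ≤ ‖T‖ * ‖(T ^ k) u‖ := T.le_opNorm _
            _ ≤ ‖T‖ * (‖T‖ ^ k * ‖u‖) := by gcongr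
            _ = _ := by ring
      exact (hle _).trans (h n)
  have hd : DenseRange (i : B →ₗ[𝕜] H) := hdense
  have hk : ∀ u : B, ‖((i.comp T : B →L[𝕜] H) : B →ₗ[𝕜] H) u‖ ≤
      ‖T‖ * ‖(i : B →ₗ[𝕜] H) u‖ := key
  refine ⟨((i.comp T : B →L[𝕜] H) : B →ₗ[𝕜] H).extendOfNorm (i : B →ₗ[𝕜] H), ?_, ?_, ?_⟩
  · intro u
    exact LinearMap.extendOfNorm_eq hd ⟨_, hk⟩ u
  · exact LinearMap.opNorm_extendOfNorm_le hd (norm_nonneg _) hk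
  · intro S hS
    refine (LinearMap.extendOfNorm_unique hd _ hk S ?_).symm
    ext u
    exact hS u
end

section
/- Let B be a separable complex Banach space, H a complex Hilbert space, and i : B → H a continuous dense embedding. Let T : B → B be a bounded linear operator symmetric with respect to the inner product of H (⟨i (T u), i v⟩_H = ⟨i u, i (T v)⟩_H for all u, v ∈ B), and let T̄ : H → H be its bounded extension to H (so that T̄ ∘ i = i ∘ T). Then the spectrum of T̄ as an operator on H is a subset of the spectrum of T as an operator on B. -/
theorem lax_real_aux (a : ℕ → ℝ) (C M : ℝ) (hM : 0 < M) (h0 : ∀ n, 0 ≤ a n)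
    (hc : ∀ n, a (n+1) ^ 2 ≤ a n * a (n+2)) (hb : ∀ n, a n ≤ C * M ^ n) :
    a 1 ≤ M * a 0 := by
  by_contra! hlt
  have ha0 : 0 < a 0 := by
    rcases (h0 0).eq_or_lt with h | h
    · have := hc 0
      rw [← h] at this hlt
      simp at this hlt
      rw [this] at hlt
      exact absurd hlt (lt_irrefl _)
    · exact h
  obtain ⟨r, hr⟩ : ∃ r, r = a 1 / a 0 := ⟨_, rfl⟩
  have hr1 : r * a 0 = a 1 := by rw [hr]; field_simp
  have hMr : M < r := by rw [hr, lt_div_iff₀ ha0]; exact hlt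
  have hr0 : 0 < r := hM.trans hMr
  have key : ∀ n, 0 < a n ∧ r * a n ≤ a (n+1) := by
    intro n
    induction n with
    | zero => exact ⟨ha0, hr1.le⟩
    | succ k ih =>
      obtain ⟨h1, h2⟩ := ih
      have h3 : 0 < a (k+1) := lt_of_lt_of_le (by positivity) h2
      refine ⟨h3, ?_⟩
      have h4 := hc k
      have h5 : r * a k * a (k+1) ≤ a k * a (k+2) := by nlinarith
      have h6 : a k * (r * a (k+1)) ≤ a k * a (k+2) := by linarith
      exact le_of_mul_le_mul_left h6 h1
  have key2 : ∀ n, r ^ n * a 0 ≤ a n := by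
    intro n
    induction n with
    | zero => simp
    | succ k ih =>
      calc r ^ (k+1) * a 0 = r * (r ^ k * a 0) := by ring
        _ ≤ r * a k := by gcongr
        _ ≤ _ := (key k).2
  obtain ⟨n, hn⟩ := pow_unbounded_of_one_lt (C / a 0) ((one_lt_div hM).2 hMr)
  have h7 := (key2 n).trans (hb n)
  rw [div_pow, div_lt_div_iff₀ ha0 (by positivity)] at hn
  linarith

/-- (Lax's theorem, part (2).) Let `B` be a separable complex Banach space, `H` a complex
Hilbert space, `i : B → H` a continuous dense embedding, `T : B → B` a bounded operator
symmetric with respect to the inner product of `H`, and `T̄ : H → H` its bounded extension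
(`T̄ ∘ i = i ∘ T`).  Then the spectrum of `T̄` on `H` is contained in the spectrum of `T`
on `B`. -/
theorem lax_theorem_spectrum_subset (B H : Type*)
    [NormedAddCommGroup B] [NormedSpace ℂ B] [CompleteSpace B]
    [TopologicalSpace.SeparableSpace B]
    [NormedAddCommGroup H] [InnerProductSpace ℂ H] [CompleteSpace H]
    (i : B →L[ℂ] H) (hinj : Function.Injective i) (hdense : DenseRange i)
    (T : B →L[ℂ] B)
    (hsym : ∀ u v : B, (inner ℂ (i (T u)) (i v) : ℂ) = inner ℂ (i u) (i (T v)))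
    (Tbar : H →L[ℂ] H) (hext : ∀ u : B, Tbar (i u) = i (T u)) :
    spectrum ℂ Tbar ⊆ spectrum ℂ T := by
  have hsa : IsSelfAdjoint Tbar := by
    rw [ContinuousLinearMap.isSelfAdjoint_iff_isSymmetric]
    intro x y
    simp only [ContinuousLinearMap.coe_coe]
    refine hdense.induction_on₂ (p := fun x y => inner ℂ (Tbar x) y = inner ℂ x (Tbar y))
      ?_ ?_ x y
    · exact isClosed_eq (by fun_prop) (by fun_prop)
    · intro u v
      rw [hext, hext]
      exact hsym u v
  intro l hl hnot
  have hreal := hsa.mem_spectrum_eq_re hl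
  have hconj : (starRingEnd ℂ) l = l := by rw [hreal]; exact Complex.conj_ofReal _
  apply hl
  obtain ⟨U, hU⟩ := (hnot : IsUnit (algebraMap ℂ (B →L[ℂ] B) l - T))
  obtain ⟨S, hS⟩ : ∃ S : B →L[ℂ] B, S = (↑U⁻¹ : B →L[ℂ] B) := ⟨_, rfl⟩
  have hS1 : ∀ u, S (l • u - T u) = u := by
    intro u
    have h : S * (algebraMap ℂ (B →L[ℂ] B) l - T) = 1 := by rw [← hU, hS]; simp
    have := congrArg (fun f : B →L[ℂ] B => f u) h
    simpa [Algebra.algebraMap_eq_smul_one] using this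
  have hS2 : ∀ u, l • S u - T (S u) = u := by
    intro u
    have h : (algebraMap ℂ (B →L[ℂ] B) l - T) * S = 1 := by rw [← hU, hS]; simp
    have := congrArg (fun f : B →L[ℂ] B => f u) h
    simpa [Algebra.algebraMap_eq_smul_one] using this
  have hSsym : ∀ u v : B, (inner ℂ (i (S u)) (i v) : ℂ) = inner ℂ (i u) (i (S v)) := by
    intro u v
    conv_lhs => rw [← hS2 v]
    conv_rhs => rw [← hS2 u]
    simp only [map_sub, map_smul, inner_sub_left, inner_sub_right, inner_smul_left,
      inner_smul_right, hconj, hsym]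
  have hbd : ∀ u, ‖i (S u)‖ ≤ (‖S‖ + 1) * ‖i u‖ := by
    intro u
    have hp : ∀ n, ‖(S ^ n) u‖ ≤ (‖S‖ + 1) ^ n * ‖u‖ := by
      intro n
      induction n with
      | zero => simp
      | succ k ih =>
        rw [pow_succ', mul_apply_eq_comp]
        calc ‖S ((S ^ k) u)‖ ≤ ‖S‖ * ‖(S ^ k) u‖ := S.le_opNorm _
          _ ≤ (‖S‖ + 1) * ((‖S‖ + 1) ^ k * ‖u‖) := by
            gcongr
            linarith
          _ = _ := by ring
    have := lax_real_aux (fun n => ‖i ((S ^ n) u)‖) (‖i‖ * ‖u‖) (‖S‖ + 1) (by positivity)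
      (fun n => norm_nonneg _) ?_ ?_
    · simpa using this
    · intro n
      have e1 : (S ^ (n+1)) u = S ((S ^ n) u) := by
        rw [pow_succ', mul_apply_eq_comp]
      have e2 : (S ^ (n+2)) u = S (S ((S ^ n) u)) := by
        rw [pow_succ', mul_apply_eq_comp, e1]
      simp only [e1, e2]
      have e3 := congrArg norm (inner_self_eq_norm_sq_to_K (𝕜 := ℂ) (i (S ((S ^ n) u))))
      rw [hSsym] at e3
      have e4 := norm_inner_le_norm (𝕜 := ℂ) (i ((S ^ n) u)) (i (S (S ((S ^ n) u))))
      rw [e3] at e4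
      simpa using e4
    · intro n
      calc ‖i ((S ^ n) u)‖ ≤ ‖i‖ * ‖(S ^ n) u‖ := i.le_opNorm _
        _ ≤ ‖i‖ * ((‖S‖ + 1) ^ n * ‖u‖) := by gcongr; exact hp n
        _ = _ := by ring
  obtain ⟨A, hA⟩ : ∃ A : H →L[ℂ] H, A = algebraMap ℂ (H →L[ℂ] H) l - Tbar := ⟨_, rfl⟩
  have hAi : ∀ u, A (i u) = i (l • u - T u) := by
    intro u
    simp [hA, Algebra.algebraMap_eq_smul_one, hext]
  have hbelow : ∀ x, ‖x‖ ≤ (‖S‖ + 1) * ‖A x‖ := by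
    intro x
    refine hdense.induction_on (p := fun x => ‖x‖ ≤ (‖S‖ + 1) * ‖A x‖) x ?_ ?_
    · exact isClosed_le (by fun_prop) (by fun_prop)
    · intro u
      have := hbd (l • u - T u)
      rwa [hS1, ← hAi] at this
  have hanti : AntilipschitzWith (‖S‖₊ + 1) A := by
    apply AddMonoidHomClass.antilipschitz_of_bound
    intro x
    simpa using hbelow x
  change IsUnit (algebraMap ℂ (H →L[ℂ] H) l - Tbar)
  rw [← hA, ContinuousLinearMap.isUnit_iff_bijective]
  refine ⟨hanti.injective, ?_⟩
  rw [← Set.range_eq_univ, ← (hanti.isClosed_range A.uniformContinuous).closure_eq]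
  apply Dense.closure_eq
  apply hdense.mono
  rintro _ ⟨u, rfl⟩
  exact ⟨i (S u), by rw [hAi, hS2]⟩
end

section
/- Let B be a complex Banach space, H a complex Hilbert space, and i : B → H a continuous dense embedding such that every f ∈ B′ has the form f(v) = ⟨i v, i u⟩_H for some u ∈ B (i.e., B′ has a Hilbert space representation via i). Then for every bounded linear operator A : B → B there exists a unique bounded linear operator A* : B → B, called the adjoint of A, satisfying ⟨i (A v), i u⟩_H = ⟨i v, i (A* u)⟩_H for all u, v ∈ B. -/
/-- Let `B` be a complex Banach space, `H` a complex Hilbert space, and `i : B → H` a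
continuous dense embedding such that every `f ∈ B′` has the form `f v = ⟨i v, i u⟩_H`
for some `u ∈ B` (Hilbert space representation of the dual; in Mathlib's convention this
reads `f v = inner (i u) (i v)`).  Then every bounded operator `A : B → B` has a unique
bounded adjoint `A* : B → B` satisfying `⟨i (A v), i u⟩_H = ⟨i v, i (A* u)⟩_H` for all
`u v ∈ B` (in Mathlib convention: `inner (i u) (i (A v)) = inner (i (A* u)) (i v)`). -/
theorem exists_unique_adjoint (B H : Type*)
    [NormedAddCommGroup B] [NormedSpace ℂ B] [CompleteSpace B]
    [NormedAddCommGroup H] [InnerProductSpace ℂ H] [CompleteSpace H]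
    (i : B →L[ℂ] H) (hinj : Function.Injective i) (hdense : DenseRange i)
    (hrep : ∀ f : B →L[ℂ] ℂ, ∃ u : B, ∀ v : B, f v = (inner ℂ (i u) (i v) : ℂ))
    (A : B →L[ℂ] B) :
    ∃! Astar : B →L[ℂ] B, ∀ u v : B,
      (inner ℂ (i u) (i (A v)) : ℂ) = inner ℂ (i (Astar u)) (i v) := by
  have key : ∀ w w' : B, (∀ v, (inner ℂ (i w) (i v) : ℂ) = inner ℂ (i w') (i v)) → w = w' := by
    intro w w' h
    apply hinj
    have h1 := h (w - w')
    rw [← sub_eq_zero, ← inner_sub_left, map_sub, inner_self_eq_zero, sub_eq_zero] at h1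
    exact h1
  have hex : ∀ u : B, ∃ w : B, ∀ v : B,
      (inner ℂ (i u) (i (A v)) : ℂ) = inner ℂ (i w) (i v) := by
    intro u
    exact hrep ((innerSL ℂ (i u)).comp (i.comp A))
  choose S hS using hex
  let T : B →ₗ[ℂ] B :=
    { toFun := S
      map_add' := by
        intro x y
        apply key
        intro v
        rw [← hS, map_add, map_add, inner_add_left, inner_add_left, hS, hS]
      map_smul' := by
        intro c x
        apply key
        intro v
        simp only [RingHom.id_apply]
        rw [← hS, map_smul, map_smul, inner_smul_left, inner_smul_left, hS] }
  have hT : Continuous T := by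
    apply LinearMap.continuous_of_seq_closed_graph
    intro u x y hu hy
    apply key
    intro v
    have h1 : Filter.Tendsto (fun n => (inner ℂ (i (T (u n))) (i v) : ℂ)) Filter.atTop
        (nhds (inner ℂ (i y) (i v))) :=
      Filter.Tendsto.inner ((i.continuous.tendsto y).comp hy) tendsto_const_nhds
    have h2 : Filter.Tendsto (fun n => (inner ℂ (i (u n)) (i (A v)) : ℂ)) Filter.atTop
        (nhds (inner ℂ (i x) (i (A v)))) :=
      Filter.Tendsto.inner ((i.continuous.tendsto x).comp hu) tendsto_const_nhds
    have h3 : (fun n => (inner ℂ (i (u n)) (i (A v)) : ℂ))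
        = fun n => (inner ℂ (i (T (u n))) (i v) : ℂ) := funext fun n => hS (u n) v
    rw [h3] at h2
    exact (tendsto_nhds_unique h1 h2).trans (hS x v)
  refine ⟨⟨T, hT⟩, fun u v => hS u v, ?_⟩
  intro R hR
  ext u
  apply key
  intro v
  exact (hR u v).symm.trans (hS u v)
end

section
/- Let n ≥ 1, let 1 ≤ p < ∞, and let (B_k)_{k≥1} be a sequence of Lebesgue-measurable subsets of ℝⁿ each of Lebesgue measure at most 1. If (f_m) is a sequence in Lᵖ(ℝⁿ) converging weakly to f ∈ Lᵖ(ℝⁿ), then ∑_{k=1}^∞ 2^{-k} | ∫_{B_k} (f_m(x) − f(x)) dx |² → 0 as m → ∞. In other words, weak convergence in Lᵖ implies strong convergence in the KS²-norm ‖g‖_{KS} = (∑_k 2^{-k} |∫_{B_k} g|²)^{1/2}. -/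
open MeasureTheory Filter
open scoped ENNReal

/-- (Weak convergence in `Lᵖ` implies strong `KS²`-convergence.) Let `1 ≤ p < ∞`, let `q` be
the conjugate exponent (`1/p + 1/q = 1`), and let `(B k)` be measurable subsets of `ℝⁿ` of
Lebesgue measure at most `1`.  If `(f m)` converges weakly to `f` in `Lᵖ(ℝⁿ)` (i.e.
`∫ f_m g → ∫ f g` for every `g ∈ L^q(ℝⁿ)`), then
`∑_{k=1}^∞ 2⁻ᵏ |∫_{B k} (f_m - f)|² → 0`, i.e. `f_m → f` in the `KS²`-norm. -/
theorem weak_Lp_convergence_implies_KS_convergence (n : ℕ) (hn : 1 ≤ n)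
    (p q : ℝ≥0∞) (hp : 1 ≤ p) (hp' : p ≠ ∞) (hpq : p⁻¹ + q⁻¹ = 1)
    (B : ℕ → Set (Fin n → ℝ)) (hBmeas : ∀ k, MeasurableSet (B k))
    (hBvol : ∀ k, volume (B k) ≤ 1)
    (f : ℕ → (Fin n → ℝ) → ℝ) (g : (Fin n → ℝ) → ℝ)
    (hf : ∀ m, MemLp (f m) p volume) (hg : MemLp g p volume)
    (hweak : ∀ φ : (Fin n → ℝ) → ℝ, MemLp φ q volume →
      Tendsto (fun m => ∫ x, f m x * φ x) atTop (nhds (∫ x, g x * φ x))) :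
    Tendsto
      (fun m => ∑' k : ℕ, ((1 : ℝ) / 2) ^ (k + 1) * |∫ x in B k, (f m x - g x)| ^ 2)
      atTop (nhds 0) := by
  have hconj : ENNReal.HolderConjugate p q := ENNReal.holderConjugate_iff.2 hpq
  have : Fact (1 ≤ p) := ⟨hp⟩
  have : Fact (1 ≤ q) := ⟨ENNReal.HolderConjugate.one_le q p⟩
  have hfin : ∀ k, volume (B k) ≠ ∞ := fun k => ((hBvol k).trans_lt ENNReal.one_lt_top).ne
  let T : ℕ → (Lp ℝ q (volume : Measure (Fin n → ℝ))) →L[ℝ] ℝ := fun m =>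
    (ContinuousLinearMap.mul ℝ ℝ).lpPairing volume p q (((hf m).sub hg).toLp _)
  have hT : ∀ m φ, T m φ = (∫ x, f m x * φ x) - ∫ x, g x * φ x := by
    intro m φ
    have h1 : Integrable (fun x => f m x * φ x) := (hf m).integrable_mul (Lp.memLp φ)
    have h2 : Integrable (fun x => g x * φ x) := hg.integrable_mul (Lp.memLp φ)
    rw [← integral_sub h1 h2]
    simp only [T]
    rw [ContinuousLinearMap.lpPairing_eq_integral]
    apply integral_congr_ae
    filter_upwards [((hf m).sub hg).coeFn_toLp] with x hx
    rw [hx]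
    simp [sub_mul]
  have hT0 : ∀ φ, Tendsto (fun m => T m φ) atTop (nhds 0) := by
    intro φ
    simp only [hT]
    simpa using (hweak φ (Lp.memLp φ)).sub_const (∫ x, g x * φ x)
  obtain ⟨C, hC⟩ : ∃ C, ∀ m, ‖T m‖ ≤ C := by
    apply banach_steinhaus
    intro φ
    obtain ⟨C, hC⟩ := (hT0 φ).norm.bddAbove_range
    exact ⟨C, fun m => hC ⟨m, rfl⟩⟩
  have hI : ∀ m k, ∫ x in B k, (f m x - g x)
      = T m (indicatorConstLp q (hBmeas k) (hfin k) (1 : ℝ)) := by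
    intro m k
    simp only [T]
    rw [ContinuousLinearMap.lpPairing_eq_integral, ← integral_indicator (hBmeas k)]
    apply integral_congr_ae
    filter_upwards [((hf m).sub hg).coeFn_toLp,
      indicatorConstLp_coeFn (p := q) (hs := hBmeas k) (hμs := hfin k) (c := (1 : ℝ))]
      with x hx hx'
    rw [hx, hx']
    by_cases h : x ∈ B k <;> simp [h]
  have hbound : ∀ m k, |∫ x in B k, (f m x - g x)| ≤ C := by
    intro m k
    rw [hI, ← Real.norm_eq_abs]
    have hnorm : ‖indicatorConstLp q (hBmeas k) (hfin k) (1 : ℝ)‖ ≤ 1 := by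
      refine norm_indicatorConstLp_le.trans ?_
      rw [norm_one, one_mul]
      exact Real.rpow_le_one measureReal_nonneg
        (ENNReal.toReal_le_of_le_ofReal zero_le_one (by simpa using hBvol k)) (by positivity)
    calc _ ≤ ‖T m‖ * ‖indicatorConstLp q (hBmeas k) (hfin k) (1 : ℝ)‖ := (T m).le_opNorm _
      _ ≤ ‖T m‖ * 1 := by gcongr
      _ ≤ C := by simpa using hC m
  have hsum : Summable (fun k : ℕ => ((1 : ℝ) / 2) ^ (k + 1) * C ^ 2) :=
    ((summable_nat_add_iff 1).2 summable_geometric_two).mul_right _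
  have key := tendsto_tsum_of_dominated_convergence (𝓕 := atTop)
    (f := fun m k => ((1 : ℝ) / 2) ^ (k + 1) * |∫ x in B k, (f m x - g x)| ^ 2)
    (g := fun _ => (0 : ℝ)) hsum
    (by
      intro k
      simp only [hI]
      simpa using (((hT0 (indicatorConstLp q (hBmeas k) (hfin k) (1 : ℝ))).abs.pow 2).const_mul
        (((1 : ℝ) / 2) ^ (k + 1))))
    (Eventually.of_forall (by
      intro m k
      rw [Real.norm_of_nonneg (by positivity)]
      have := hbound m k
      gcongr))
  simpa only [tsum_zero] using key
end
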